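/- arXiv:2204.10782 — 5 statements merged into one kernel-verified Lean document; each statement's English description precedes it below -/
import Mathlib

section
/- Along any gradient-flow trajectory of the second-layer weights, the time derivative of the training loss satisfies dL^t/dt = −(ĉ²/m) ∑_{i=1}^m ∑_{a,b=1}^n G_{ab} (f^t(x_a) − y_a)(f^t(x_b) − y_b) σ'(h_i^t(x_a)) σ'(h_i^t(x_b)) ≤ −(ĉ² λ_min(G)/m) ∑_{i=1}^m ∑_{a=1}^n (f^t(x_a) − y_a)² (σ'(h_i^t(x_a)))² ≤ 0; in particular t ↦ L^t is non-increasing. -/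
open Real MeasureTheory ProbabilityTheory
open scoped BigOperators ENNReal NNReal

noncomputable section

namespace GFPaper

variable {α : Type*}

/-- Hidden-layer feature map `h_i(x) = (1/√D) ∑_j W_{ij} φ_j(x)`. -/
def feat {m D : ℕ} (φ : Fin D → α → ℝ) (W : Fin m → Fin D → ℝ) (i : Fin m) (x : α) : ℝ :=
  (Real.sqrt D)⁻¹ * ∑ j, W i j * φ j x

/-- Network output `f_W(x) = (1/m) ∑_i c_i σ(h_i(x))`. -/
def net {m D : ℕ} (c : Fin m → ℝ) (σ : ℝ → ℝ) (φ : Fin D → α → ℝ)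
    (W : Fin m → Fin D → ℝ) (x : α) : ℝ :=
  (m : ℝ)⁻¹ * ∑ i, c i * σ (feat φ W i x)

/-- Empirical squared loss `L[W] = (1/2) ∑_a (f_W(x_a) - y_a)^2`. -/
def sqLoss {n m D : ℕ} (c : Fin m → ℝ) (σ : ℝ → ℝ) (φ : Fin D → α → ℝ)
    (x : Fin n → α) (y : Fin n → ℝ) (W : Fin m → Fin D → ℝ) : ℝ :=
  (1/2) * ∑ a, (net c σ φ W (x a) - y a)^2

/-- Gram matrix `G_{ab} = (1/D) Φ(x_a)·Φ(x_b)`. -/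
def gram {n D : ℕ} (φ : Fin D → α → ℝ) (x : Fin n → α) (a b : Fin n) : ℝ :=
  (D : ℝ)⁻¹ * ∑ j, φ j (x a) * φ j (x b)

/-- Gradient-flow equation for the trainable weights `W`, on `[0,∞)`:
`Ẇ^t_{ij} = -(c_i/√D) ∑_a (f^t(x_a) - y_a) σ'(h_i^t(x_a)) φ_j(x_a)`. -/
def IsGF {n m D : ℕ} (c : Fin m → ℝ) (σ : ℝ → ℝ) (φ : Fin D → α → ℝ)
    (x : Fin n → α) (y : Fin n → ℝ) (W : ℝ → Fin m → Fin D → ℝ) : Prop :=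
  ∀ t : ℝ, 0 ≤ t → ∀ i j, HasDerivAt (fun s => W s i j)
    (-(c i / Real.sqrt D) * ∑ a, (net c σ φ (W t) (x a) - y a)
        * deriv σ (feat φ (W t) i (x a)) * φ j (x a)) t

/-- Along any gradient-flow trajectory of the second-layer weights, the time
derivative of the training loss equals
`-(chat²/m) ∑_i ∑_{a,b} G_{ab} (f^t(x_a)-y_a)(f^t(x_b)-y_b) σ'(h_i^t(x_a)) σ'(h_i^t(x_b))`,
which is bounded above by
`-(chat² λ_min(G)/m) ∑_i ∑_a (f^t(x_a)-y_a)² (σ'(h_i^t(x_a)))² ≤ 0`;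
in particular the loss is non-increasing along the trajectory. -/
theorem loss_derivative_along_gradient_flow
    {n m D : ℕ} (hm : 0 < m) (hD : 0 < D)
    (φ : Fin D → α → ℝ) (x : Fin n → α) (y : Fin n → ℝ)
    (σ : ℝ → ℝ) (Lσ : ℝ) (hLσ : 0 < Lσ)
    (hσdiff : Differentiable ℝ σ) (hσlip : LipschitzWith (Real.toNNReal Lσ) σ)
    (chat : ℝ) (hchat : 0 < chat) (c : Fin m → ℝ) (hc : ∀ i, |c i| = chat)
    (lamMin : ℝ) (hlamMin0 : 0 ≤ lamMin)
    (hlamMin : ∀ v : Fin n → ℝ,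
      lamMin * ∑ a, (v a) ^ 2 ≤ ∑ a, ∑ b, v a * gram φ x a b * v b)
    (W : ℝ → Fin m → Fin D → ℝ) (hGF : IsGF c σ φ x y W) :
    (∀ t : ℝ, 0 ≤ t →
      HasDerivAt (fun s => sqLoss c σ φ x y (W s))
        (-(chat ^ 2 / m) * ∑ i, ∑ a, ∑ b, gram φ x a b
            * (net c σ φ (W t) (x a) - y a) * (net c σ φ (W t) (x b) - y b)
            * deriv σ (feat φ (W t) i (x a)) * deriv σ (feat φ (W t) i (x b))) t
      ∧ -(chat ^ 2 / m) * ∑ i, ∑ a, ∑ b, gram φ x a b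
            * (net c σ φ (W t) (x a) - y a) * (net c σ φ (W t) (x b) - y b)
            * deriv σ (feat φ (W t) i (x a)) * deriv σ (feat φ (W t) i (x b))
          ≤ -(chat ^ 2 * lamMin / m) * ∑ i, ∑ a,
              (net c σ φ (W t) (x a) - y a) ^ 2 * (deriv σ (feat φ (W t) i (x a))) ^ 2
      ∧ -(chat ^ 2 * lamMin / m) * ∑ i, ∑ a,
              (net c σ φ (W t) (x a) - y a) ^ 2 * (deriv σ (feat φ (W t) i (x a))) ^ 2
          ≤ 0)
    ∧ ∀ t₁ t₂ : ℝ, 0 ≤ t₁ → t₁ ≤ t₂ →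
        sqLoss c σ φ x y (W t₂) ≤ sqLoss c σ φ x y (W t₁) := by
  have hDr : (0:ℝ) < D := by exact_mod_cast hD
  have hmr : (0:ℝ) < m := by exact_mod_cast hm
  have hc2 : ∀ i, c i * c i = chat ^ 2 := by
    intro i
    rw [← hc i, sq_abs, sq]
  have hfeat : ∀ t : ℝ, 0 ≤ t → ∀ i a, HasDerivAt (fun s => feat φ (W s) i (x a))
      (-(c i) * ∑ b, gram φ x a b * (net c σ φ (W t) (x b) - y b)
        * deriv σ (feat φ (W t) i (x b))) t := by
    intro t ht i a
    unfold feat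
    have h1 := (HasDerivAt.fun_sum (u := Finset.univ) (fun (j : Fin D) _ =>
      (hGF t ht i j).mul_const (φ j (x a)))).const_mul ((Real.sqrt D)⁻¹)
    refine h1.congr_deriv ?_
    have hs : (Real.sqrt D)⁻¹ * (Real.sqrt D)⁻¹ = (D:ℝ)⁻¹ := by
      rw [← mul_inv, Real.mul_self_sqrt hDr.le]
    unfold gram
    rw [← hs]
    simp only [Finset.mul_sum, Finset.sum_mul]
    rw [Finset.sum_comm]
    refine Finset.sum_congr rfl fun b _ => Finset.sum_congr rfl fun j _ => ?_
    simp only [feat, Finset.mul_sum, div_eq_mul_inv]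
    ring
  have hder : ∀ t : ℝ, 0 ≤ t → HasDerivAt (fun s => sqLoss c σ φ x y (W s))
        (-(chat ^ 2 / m) * ∑ i, ∑ a, ∑ b, gram φ x a b
            * (net c σ φ (W t) (x a) - y a) * (net c σ φ (W t) (x b) - y b)
            * deriv σ (feat φ (W t) i (x a)) * deriv σ (feat φ (W t) i (x b))) t := by
    intro t ht
    have hnet : ∀ a, HasDerivAt (fun s => net c σ φ (W s) (x a)) _ t := fun a =>
      (HasDerivAt.fun_sum (u := Finset.univ) (fun (i : Fin m) _ =>
        (((hσdiff (feat φ (W t) i (x a))).hasDerivAt.comp t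
          (hfeat t ht i a)).const_mul (c i)))).const_mul ((m:ℝ)⁻¹)
    have h2 := (HasDerivAt.fun_sum (u := Finset.univ) (fun (a : Fin n) _ =>
      ((hnet a).sub_const (y a)).fun_pow 2)).const_mul (1/2:ℝ)
    refine h2.congr_deriv ?_
    simp only [Finset.mul_sum]
    rw [Finset.sum_comm]
    refine Finset.sum_congr rfl fun i _ => Finset.sum_congr rfl fun a _ =>
      Finset.sum_congr rfl fun b _ => ?_
    rw [← hc2 i, div_eq_mul_inv]
    push_cast
    ring
  have hle : ∀ t : ℝ, -(chat ^ 2 / m) * ∑ i, ∑ a, ∑ b, gram φ x a b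
            * (net c σ φ (W t) (x a) - y a) * (net c σ φ (W t) (x b) - y b)
            * deriv σ (feat φ (W t) i (x a)) * deriv σ (feat φ (W t) i (x b))
          ≤ -(chat ^ 2 * lamMin / m) * ∑ i, ∑ a,
              (net c σ φ (W t) (x a) - y a) ^ 2 * (deriv σ (feat φ (W t) i (x a))) ^ 2 := by
    intro t
    have h : lamMin * ∑ i, ∑ a,
              (net c σ φ (W t) (x a) - y a) ^ 2 * (deriv σ (feat φ (W t) i (x a))) ^ 2
        ≤ ∑ i, ∑ a, ∑ b, gram φ x a b
            * (net c σ φ (W t) (x a) - y a) * (net c σ φ (W t) (x b) - y b)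
            * deriv σ (feat φ (W t) i (x a)) * deriv σ (feat φ (W t) i (x b)) := by
      rw [Finset.mul_sum]
      refine Finset.sum_le_sum fun i _ => ?_
      have := hlamMin (fun a => (net c σ φ (W t) (x a) - y a) * deriv σ (feat φ (W t) i (x a)))
      simp only [mul_pow] at this
      refine this.trans (le_of_eq ?_)
      refine Finset.sum_congr rfl fun a _ => Finset.sum_congr rfl fun b _ => ?_
      ring
    have h3 := mul_le_mul_of_nonneg_left h (by positivity : (0:ℝ) ≤ chat ^ 2 / m)
    have h4 : chat ^ 2 * lamMin / m = chat ^ 2 / m * lamMin := by ring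
    rw [h4, neg_mul, neg_mul, mul_assoc (chat ^ 2 / (m:ℝ)) lamMin]
    exact neg_le_neg h3
  have hle0 : ∀ t : ℝ, -(chat ^ 2 * lamMin / m) * ∑ i, ∑ a,
              (net c σ φ (W t) (x a) - y a) ^ 2 * (deriv σ (feat φ (W t) i (x a))) ^ 2
          ≤ 0 := by
    intro t
    rw [neg_mul]
    exact neg_nonpos.mpr (by positivity)
  refine ⟨fun t ht => ⟨hder t ht, hle t, hle0 t⟩, ?_⟩
  intro t₁ t₂ h1 h12
  have hanti : AntitoneOn (fun s => sqLoss c σ φ x y (W s)) (Set.Ici 0) := by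
    refine antitoneOn_of_deriv_nonpos (convex_Ici 0)
      (fun t ht => (hder t ht).continuousAt.continuousWithinAt) ?_ ?_
    · intro t ht
      rw [interior_Ici] at ht
      exact (hder t (le_of_lt ht)).differentiableAt.differentiableWithinAt
    · intro t ht
      rw [interior_Ici] at ht
      rw [(hder t (le_of_lt ht)).deriv]
      exact (hle t).trans (hle0 t)
  exact hanti h1 (h1.trans h12) h12

end GFPaper
end
end

section
/- Suppose in addition that |σ'(u)| ≥ K_{σ'} > 0 for all u ∈ ℝ and λ_min(G) > 0. Then along any gradient-flow trajectory, dL^t/dt ≤ −2 ĉ² λ_min(G) (K_{σ'})² L^t for all t ≥ 0, and consequently L^t ≤ L^0 · exp(−2 ĉ² λ_min(G) (K_{σ'})² t) for all t ≥ 0; i.e., the training loss converges to zero at a linear rate. -/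
open Real MeasureTheory ProbabilityTheory
open scoped BigOperators ENNReal NNReal

noncomputable section

namespace GFPaper

variable {α : Type*}

/-- Derivative of the loss along the flow. -/
theorem loss_deriv
    {n m D : ℕ} (hm : 0 < m) (hD : 0 < D)
    (φ : Fin D → α → ℝ) (x : Fin n → α) (y : Fin n → ℝ)
    (σ : ℝ → ℝ) (hσdiff : Differentiable ℝ σ)
    (Kσ' : ℝ) (hK : 0 < Kσ') (hσ' : ∀ u : ℝ, Kσ' ≤ |deriv σ u|)
    (chat : ℝ) (c : Fin m → ℝ) (hc : ∀ i, |c i| = chat)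
    (lamMin : ℝ) (hlamMinpos : 0 < lamMin)
    (hlamMin : ∀ v : Fin n → ℝ,
      lamMin * ∑ a, (v a) ^ 2 ≤ ∑ a, ∑ b, v a * gram φ x a b * v b)
    (W : ℝ → Fin m → Fin D → ℝ) (hGF : IsGF c σ φ x y W) (t : ℝ) (ht : 0 ≤ t) :
    ∃ L' : ℝ, HasDerivAt (fun s => sqLoss c σ φ x y (W s)) L' t ∧
        L' ≤ -(2 * chat ^ 2 * lamMin * Kσ' ^ 2) * sqLoss c σ φ x y (W t) := by
  have hW := hGF t ht
  set r : Fin n → ℝ := fun a => net c σ φ (W t) (x a) - y a with hr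
  set d : Fin m → Fin n → ℝ := fun i a => deriv σ (feat φ (W t) i (x a)) with hd
  have hfeat : ∀ i a, HasDerivAt (fun s => feat φ (W s) i (x a))
      (-(c i) * ∑ b, gram φ x a b * (r b * d i b)) t := by
    intro i a
    have h1 := (HasDerivAt.fun_sum (u := Finset.univ) (fun j _ =>
      (hW i j).mul_const (φ j (x a)))).const_mul (Real.sqrt D)⁻¹
    refine h1.congr_deriv ?_
    have hs : (D : ℝ)⁻¹ = (Real.sqrt D)⁻¹ * (Real.sqrt D)⁻¹ := by
      rw [← mul_inv, Real.mul_self_sqrt (Nat.cast_nonneg D)]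
    simp only [gram, hs, Finset.mul_sum, Finset.sum_mul]
    rw [Finset.sum_comm]
    refine Finset.sum_congr rfl fun b _ => Finset.sum_congr rfl fun j _ => ?_
    simp only [hr, hd]
    ring
  have hnet : ∀ a, HasDerivAt (fun s => net c σ φ (W s) (x a))
      ((m : ℝ)⁻¹ * ∑ i, c i * (d i a * (-(c i) * ∑ b, gram φ x a b * (r b * d i b)))) t := by
    intro a
    exact (HasDerivAt.fun_sum (u := Finset.univ) (fun i _ =>
      (((hσdiff _).hasDerivAt.comp t (hfeat i a)).const_mul (c i)))).const_mul _
  have hloss : HasDerivAt (fun s => sqLoss c σ φ x y (W s)) _ t :=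
    (HasDerivAt.fun_sum (u := Finset.univ) (fun a _ =>
      ((hnet a).sub_const (y a)).pow 2)).const_mul (1/2)
  refine ⟨_, hloss, ?_⟩
  have hmpos : (0 : ℝ) < m := Nat.cast_pos.2 hm
  have key : ∀ i, chat ^ 2 * (lamMin * (Kσ' ^ 2 * ∑ a, r a ^ 2)) ≤
      c i ^ 2 * ∑ a, ∑ b, (r a * d i a) * gram φ x a b * (r b * d i b) := by
    intro i
    have hci : c i ^ 2 = chat ^ 2 := by rw [← hc i, sq_abs]
    rw [hci]
    refine mul_le_mul_of_nonneg_left ?_ (sq_nonneg _)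
    refine le_trans ?_ (hlamMin (fun a => r a * d i a))
    refine mul_le_mul_of_nonneg_left ?_ hlamMinpos.le
    rw [Finset.mul_sum]
    refine Finset.sum_le_sum fun a _ => ?_
    have h2 : Kσ' ^ 2 ≤ d i a ^ 2 := by
      rw [← sq_abs (d i a)]
      exact pow_le_pow_left₀ hK.le (hσ' _) 2
    calc Kσ' ^ 2 * r a ^ 2 ≤ d i a ^ 2 * r a ^ 2 := mul_le_mul_of_nonneg_right h2 (sq_nonneg _)
      _ = (r a * d i a) ^ 2 := by ring
  have hsum := Finset.sum_le_sum (fun i (_ : i ∈ Finset.univ) => key i)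
  rw [Finset.sum_const, Finset.card_univ, Fintype.card_fin, nsmul_eq_mul] at hsum
  have hsum2 := mul_le_mul_of_nonneg_left hsum (inv_nonneg.2 hmpos.le)
  rw [inv_mul_cancel_left₀ hmpos.ne'] at hsum2
  have hR : -(2 * chat ^ 2 * lamMin * Kσ' ^ 2) * sqLoss c σ φ x y (W t) =
      -(chat ^ 2 * (lamMin * (Kσ' ^ 2 * ∑ a, r a ^ 2))) := by
    simp only [sqLoss, hr]; ring
  rw [hR]
  refine le_trans (le_of_eq ?_) (neg_le_neg hsum2)
  simp only [Finset.mul_sum, ← Finset.sum_neg_distrib]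
  rw [Finset.sum_comm]
  refine Finset.sum_congr rfl fun i _ => Finset.sum_congr rfl fun a _ =>
    Finset.sum_congr rfl fun b _ => ?_
  simp only [hr]
  push_cast
  ring

/-- If `|σ'(u)| ≥ K_{σ'} > 0` for all `u` and `λ_min(G) > 0`, then along any
gradient-flow trajectory `dL^t/dt ≤ -2 ĉ² λ_min(G) K_{σ'}² L^t` for all `t ≥ 0`, and hence
`L^t ≤ L^0 · exp(-2 ĉ² λ_min(G) K_{σ'}² t)`: the loss converges to zero at a linear rate. -/
theorem linear_convergence_uniform_active
    {n m D : ℕ} (hm : 0 < m) (hD : 0 < D)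
    (φ : Fin D → α → ℝ) (x : Fin n → α) (y : Fin n → ℝ)
    (σ : ℝ → ℝ) (Lσ : ℝ) (hLσ : 0 < Lσ)
    (hσdiff : Differentiable ℝ σ) (hσlip : LipschitzWith (Real.toNNReal Lσ) σ)
    (Kσ' : ℝ) (hK : 0 < Kσ') (hσ' : ∀ u : ℝ, Kσ' ≤ |deriv σ u|)
    (chat : ℝ) (hchat : 0 < chat) (c : Fin m → ℝ) (hc : ∀ i, |c i| = chat)
    (lamMin : ℝ) (hlamMinpos : 0 < lamMin)
    (hlamMin : ∀ v : Fin n → ℝ,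
      lamMin * ∑ a, (v a) ^ 2 ≤ ∑ a, ∑ b, v a * gram φ x a b * v b)
    (W : ℝ → Fin m → Fin D → ℝ) (hGF : IsGF c σ φ x y W) :
    (∀ t : ℝ, 0 ≤ t → ∀ L' : ℝ,
      HasDerivAt (fun s => sqLoss c σ φ x y (W s)) L' t →
        L' ≤ -(2 * chat ^ 2 * lamMin * Kσ' ^ 2) * sqLoss c σ φ x y (W t))
    ∧ ∀ t : ℝ, 0 ≤ t →
        sqLoss c σ φ x y (W t)
          ≤ sqLoss c σ φ x y (W 0) * Real.exp (-(2 * chat ^ 2 * lamMin * Kσ' ^ 2) * t) := by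
  have H := loss_deriv hm hD φ x y σ hσdiff Kσ' hK hσ' chat c hc lamMin hlamMinpos hlamMin W hGF
  refine ⟨fun t ht L' hL' => ?_, fun t ht => ?_⟩
  · obtain ⟨L₁, h1, h2⟩ := H t ht
    rw [hL'.unique h1]
    exact h2
  · set k := 2 * chat ^ 2 * lamMin * Kσ' ^ 2 with hk
    have hE : ∀ s : ℝ, HasDerivAt (fun s => Real.exp (k * s)) (Real.exp (k * s) * (k * 1)) s :=
      fun s => ((hasDerivAt_id s).const_mul k).exp
    have hanti : AntitoneOn (fun s => sqLoss c σ φ x y (W s) * Real.exp (k * s)) (Set.Ici 0) := by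
      apply antitoneOn_of_deriv_nonpos (convex_Ici 0)
      · intro s hs
        obtain ⟨L₁, h1, h2⟩ := H s hs
        exact (h1.mul (hE s)).continuousAt.continuousWithinAt
      · intro s hs
        rw [interior_Ici] at hs
        obtain ⟨L₁, h1, h2⟩ := H s (le_of_lt hs)
        exact (h1.mul (hE s)).differentiableAt.differentiableWithinAt
      · intro s hs
        rw [interior_Ici] at hs
        obtain ⟨L₁, h1, h2⟩ := H s (le_of_lt hs)
        have h3 : deriv (fun s => sqLoss c σ φ x y (W s) * Real.exp (k * s)) s = _ :=
          (h1.mul (hE s)).deriv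
        rw [h3]
        have := mul_le_mul_of_nonneg_right h2 (Real.exp_pos (k * s)).le
        linarith
    have h := hanti (Set.mem_Ici.2 le_rfl) (Set.mem_Ici.2 ht) ht
    simp only [mul_zero, Real.exp_zero, mul_one] at h
    have h4 := mul_le_mul_of_nonneg_right h (Real.exp_pos (-k * t)).le
    rwa [mul_assoc, ← Real.exp_add, show k * t + -k * t = 0 by ring, Real.exp_zero,
      mul_one] at h4

end GFPaper
end
end

section
/- Along any gradient-flow trajectory with λ_min(G) > 0 and |c_i| = ĉ > 0 for all i, the loss satisfies for every t ≥ 0 the differential inequality dL^t/dt ≤ −2 ĉ² λ_min(G) (K_{σ'})² η^t L^t, where η^t = min_{a∈[n]} (1/m) ∑_{i=1}^m 1{h_i^t(x_a) ∈ I} is the smallest (over training points) fraction of neurons whose pre-activation lies in the active region I. -/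
open Real MeasureTheory ProbabilityTheory
open scoped BigOperators ENNReal NNReal

noncomputable section

namespace GFPaper

variable {α : Type*}

/-- Along any gradient-flow trajectory with `λ_min(G) > 0` and `|c_i| = ĉ > 0`,
the loss satisfies `dL^t/dt ≤ -2 ĉ² λ_min(G) K_{σ'}² η^t L^t`, where
`η^t = min_a (1/m) ∑_i 1{h_i^t(x_a) ∈ I}` is the smallest fraction of neurons whose
pre-activation lies in the active region `I = (I_l, I_r)`. -/
theorem loss_derivative_bound_active_fraction
    {n m D : ℕ} (hn : 0 < n) (hm : 0 < m) (hD : 0 < D)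
    (φ : Fin D → α → ℝ) (x : Fin n → α) (y : Fin n → ℝ)
    (σ : ℝ → ℝ) (Lσ : ℝ) (hLσ : 0 < Lσ)
    (hσdiff : Differentiable ℝ σ) (hσlip : LipschitzWith (Real.toNNReal Lσ) σ)
    (Il Ir : ℝ) (hI : Il < Ir) (Kσ' : ℝ) (hK : 0 < Kσ')
    (hσ' : ∀ u : ℝ, Il < u → u < Ir → Kσ' ≤ |deriv σ u|)
    (chat : ℝ) (hchat : 0 < chat) (c : Fin m → ℝ) (hc : ∀ i, |c i| = chat)
    (lamMin : ℝ) (hlamMinpos : 0 < lamMin)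
    (hlamMin : ∀ v : Fin n → ℝ,
      lamMin * ∑ a, (v a) ^ 2 ≤ ∑ a, ∑ b, v a * gram φ x a b * v b)
    (W : ℝ → Fin m → Fin D → ℝ) (hGF : IsGF c σ φ x y W) :
    ∀ t : ℝ, 0 ≤ t → ∀ L' : ℝ,
      HasDerivAt (fun s => sqLoss c σ φ x y (W s)) L' t →
        L' ≤ -(2 * chat ^ 2 * lamMin * Kσ' ^ 2)
          * (Finset.univ.inf' (Finset.univ_nonempty_iff.mpr ⟨⟨0, hn⟩⟩) fun a =>
              (m : ℝ)⁻¹ * ∑ i,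
                if Il < feat φ (W t) i (x a) ∧ feat φ (W t) i (x a) < Ir then (1 : ℝ) else 0)
          * sqLoss c σ φ x y (W t) := by
  intro t ht L' hL'
  set r : Fin n → ℝ := fun a => net c σ φ (W t) (x a) - y a with hr
  set s : Fin m → Fin n → ℝ := fun i a => deriv σ (feat φ (W t) i (x a)) with hs
  have hDpos : (0 : ℝ) < D := by exact_mod_cast hD
  have hmpos : (0 : ℝ) < m := by exact_mod_cast hm
  have hsq : (Real.sqrt D)⁻¹ * (Real.sqrt D)⁻¹ = (D : ℝ)⁻¹ := by
    rw [← mul_inv, Real.mul_self_sqrt hDpos.le]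
  have hfeat : ∀ i a, HasDerivAt (fun u => feat φ (W u) i (x a))
      (-(c i) * ∑ b, gram φ x a b * (r b * s i b)) t := by
    intro i a
    have h1 : HasDerivAt (fun u => feat φ (W u) i (x a))
        ((Real.sqrt D)⁻¹ * ∑ j, (-(c i / Real.sqrt D) * ∑ b, r b * s i b * φ j (x b)) * φ j (x a))
        t := by
      unfold feat
      exact (HasDerivAt.fun_sum fun j _ => (hGF t ht i j).mul_const _).const_mul _
    convert h1 using 1
    simp only [gram, Finset.mul_sum, Finset.sum_mul]
    rw [Finset.sum_comm]
    refine Finset.sum_congr rfl fun j _ => Finset.sum_congr rfl fun b _ => ?_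
    rw [← hsq]
    ring
  have hnet : ∀ a, HasDerivAt (fun u => net c σ φ (W u) (x a))
      ((m : ℝ)⁻¹ * ∑ i, c i * (s i a * (-(c i) * ∑ b, gram φ x a b * (r b * s i b)))) t := by
    intro a
    unfold net
    exact (HasDerivAt.fun_sum fun i _ =>
      (((hσdiff _).hasDerivAt.comp t (hfeat i a)).const_mul (c i))).const_mul _
  have hloss : HasDerivAt (fun u => sqLoss c σ φ x y (W u))
      ((1/2) * ∑ a, (2 * r a *
        ((m : ℝ)⁻¹ * ∑ i, c i * (s i a * (-(c i) * ∑ b, gram φ x a b * (r b * s i b)))))) t := by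
    unfold sqLoss
    refine (HasDerivAt.fun_sum fun a _ => ?_).const_mul _
    simpa using ((hnet a).sub_const (y a)).fun_pow 2
  have hL : L' = -((m : ℝ)⁻¹ * chat ^ 2 *
      ∑ i, ∑ a, ∑ b, (r a * s i a) * gram φ x a b * (r b * s i b)) := by
    rw [hL'.unique hloss]
    simp only [Finset.mul_sum, ← Finset.sum_neg_distrib]
    rw [Finset.sum_comm]
    refine Finset.sum_congr rfl fun i _ => Finset.sum_congr rfl fun a _ =>
      Finset.sum_congr rfl fun b _ => ?_
    rw [← hc i, sq_abs]
    ring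
  set η := (Finset.univ.inf' (Finset.univ_nonempty_iff.mpr ⟨⟨0, hn⟩⟩) fun a =>
              (m : ℝ)⁻¹ * ∑ i,
                if Il < feat φ (W t) i (x a) ∧ feat φ (W t) i (x a) < Ir then (1 : ℝ) else 0) with hη
  have hηle : ∀ a, η * Kσ' ^ 2 ≤ (m : ℝ)⁻¹ * ∑ i, s i a ^ 2 := by
    intro a
    have h1 : η ≤ (m : ℝ)⁻¹ * ∑ i,
        if Il < feat φ (W t) i (x a) ∧ feat φ (W t) i (x a) < Ir then (1 : ℝ) else 0 :=
      Finset.inf'_le (f := fun a => (m : ℝ)⁻¹ * ∑ i,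
        if Il < feat φ (W t) i (x a) ∧ feat φ (W t) i (x a) < Ir then (1 : ℝ) else 0)
        (Finset.mem_univ a)
    refine (mul_le_mul_of_nonneg_right h1 (sq_nonneg _)).trans ?_
    rw [mul_assoc, Finset.sum_mul]
    refine mul_le_mul_of_nonneg_left (Finset.sum_le_sum fun i _ => ?_) (inv_nonneg.mpr hmpos.le)
    split_ifs with h
    · rw [one_mul, ← sq_abs (s i a)]
      exact pow_le_pow_left₀ hK.le (hσ' _ h.1 h.2) 2
    · rw [zero_mul]
      positivity
  have key : lamMin * (η * Kσ' ^ 2 * ∑ a, r a ^ 2) ≤ (m : ℝ)⁻¹ *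
      ∑ i, ∑ a, ∑ b, (r a * s i a) * gram φ x a b * (r b * s i b) := by
    have h2 : η * Kσ' ^ 2 * ∑ a, r a ^ 2 ≤ (m : ℝ)⁻¹ * ∑ i, ∑ a, (r a * s i a) ^ 2 := by
      rw [Finset.sum_comm, Finset.mul_sum, Finset.mul_sum]
      refine Finset.sum_le_sum fun a _ => ?_
      refine (mul_le_mul_of_nonneg_right (hηle a) (sq_nonneg _)).trans (le_of_eq ?_)
      simp only [mul_pow, ← Finset.mul_sum]
      ring
    refine (mul_le_mul_of_nonneg_left h2 hlamMinpos.le).trans ?_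
    rw [mul_left_comm, Finset.mul_sum]
    exact mul_le_mul_of_nonneg_left
      (Finset.sum_le_sum fun i _ => hlamMin fun a => r a * s i a) (inv_nonneg.mpr hmpos.le)
  have h3 := mul_le_mul_of_nonneg_left key (sq_nonneg chat)
  have h4 : sqLoss c σ φ x y (W t) = (1/2) * ∑ a, r a ^ 2 := rfl
  rw [hL, h4]
  linarith

end GFPaper
end
end

section
/- Along any gradient-flow trajectory with λ_min(G) > 0 and |c_i| = ĉ > 0 for all i, the induced feature dynamics ḣ_i^t(x_a) = −c_i ∑_{b=1}^n G_{ab} (f^t(x_b) − y_b) σ'(h_i^t(x_b)) satisfy, for every t ≥ 0 and every a ∈ [n], the velocity bound (1/m) ∑_{i=1}^m |ḣ_i^t(x_a)| ≤ λ_max(G) (λ_min(G))^{−1/2} |dL^t/dt|^{1/2}. -/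
open Real MeasureTheory ProbabilityTheory
open scoped BigOperators ENNReal NNReal

noncomputable section

namespace GFPaper

variable {α : Type*}

theorem feat_deriv_aux {n m D : ℕ} (hD : 0 < D)
    (φ : Fin D → α → ℝ) (x : Fin n → α) (y : Fin n → ℝ) (σ : ℝ → ℝ) (c : Fin m → ℝ)
    (W : ℝ → Fin m → Fin D → ℝ) (hGF : IsGF c σ φ x y W) (t : ℝ) (ht : 0 ≤ t)
    (i : Fin m) (a : Fin n) :
    HasDerivAt (fun s => feat φ (W s) i (x a))
      ((-(c i)) * ∑ b, gram φ x a b * (net c σ φ (W t) (x b) - y b)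
                * deriv σ (feat φ (W t) i (x b))) t := by
  have h1 : HasDerivAt (fun s => feat φ (W s) i (x a)) _ t :=
    (HasDerivAt.fun_sum (u := Finset.univ) (fun j _ =>
      (hGF t ht i j).mul_const (φ j (x a)))).const_mul ((Real.sqrt D)⁻¹)
  convert h1 using 1
  have hs : (D : ℝ)⁻¹ = (Real.sqrt D)⁻¹ * (Real.sqrt D)⁻¹ := by
    rw [← mul_inv, Real.mul_self_sqrt (Nat.cast_nonneg D)]
  unfold gram
  rw [hs]
  simp only [Finset.mul_sum, Finset.sum_mul]
  rw [Finset.sum_comm]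
  refine Finset.sum_congr rfl fun j _ => Finset.sum_congr rfl fun b _ => ?_
  ring

theorem gram_quad_aux {n D : ℕ} (φ : Fin D → α → ℝ) (x : Fin n → α) (v : Fin n → ℝ) :
    ∑ a, ∑ b, v a * gram φ x a b * v b
      = (D : ℝ)⁻¹ * ∑ j, (∑ b, φ j (x b) * v b) ^ 2 := by
  unfold gram
  simp only [sq, Finset.mul_sum, Finset.sum_mul]
  symm
  rw [Finset.sum_comm]
  refine Finset.sum_congr rfl fun a _ => ?_
  rw [Finset.sum_comm]
  refine Finset.sum_congr rfl fun b _ => Finset.sum_congr rfl fun j _ => ?_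
  ring

theorem gram_row_aux {n D : ℕ} (φ : Fin D → α → ℝ) (x : Fin n → α)
    (lamMax : ℝ)
    (hlamMax : ∀ v : Fin n → ℝ,
      ∑ a, ∑ b, v a * gram φ x a b * v b ≤ lamMax * ∑ a, (v a) ^ 2)
    (v : Fin n → ℝ) (a : Fin n) :
    0 ≤ lamMax ∧ (∑ b, gram φ x a b * v b) ^ 2 ≤ lamMax ^ 2 * ∑ b, (v b) ^ 2 := by
  have hD0 : (0 : ℝ) ≤ (D : ℝ)⁻¹ := by positivity
  have e1 : ∑ b, gram φ x a b * v b
      = (D : ℝ)⁻¹ * ∑ j, φ j (x a) * (∑ b, φ j (x b) * v b) := by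
    unfold gram
    simp only [Finset.mul_sum, Finset.sum_mul]
    rw [Finset.sum_comm]
    refine Finset.sum_congr rfl fun j _ => Finset.sum_congr rfl fun b _ => ?_
    ring
  have h1 := hlamMax (Pi.single a 1)
  have h2 := hlamMax v
  rw [gram_quad_aux] at h1 h2
  have e2 : ∑ b, (Pi.single a (1 : ℝ) : Fin n → ℝ) b ^ 2 = 1 := by
    simp [Pi.single_apply]
  have e3 : ∀ j, ∑ b, φ j (x b) * (Pi.single a (1 : ℝ) : Fin n → ℝ) b = φ j (x a) := by
    intro j; simp [Pi.single_apply]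
  simp only [e2, e3, mul_one] at h1
  have cs := Finset.sum_mul_sq_le_sq_mul_sq Finset.univ (fun j => φ j (x a))
    (fun j => ∑ b, φ j (x b) * v b)
  have p1 : 0 ≤ (D : ℝ)⁻¹ * ∑ j, φ j (x a) ^ 2 := by positivity
  have p2 : 0 ≤ (D : ℝ)⁻¹ * ∑ j, (∑ b, φ j (x b) * v b) ^ 2 := by positivity
  refine ⟨p1.trans h1, ?_⟩
  rw [e1]
  have hm := mul_le_mul h1 h2 p2 (p1.trans h1)
  have := mul_le_mul_of_nonneg_left cs (sq_nonneg (D : ℝ)⁻¹)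
  nlinarith

/-- Along any gradient-flow trajectory with `λ_min(G) > 0` and `|c_i| = ĉ > 0`,
the induced feature velocities `ḣ_i^t(x_a) = -c_i ∑_b G_{ab} (f^t(x_b)-y_b) σ'(h_i^t(x_b))`
satisfy `(1/m) ∑_i |ḣ_i^t(x_a)| ≤ λ_max(G) λ_min(G)^{-1/2} |dL^t/dt|^{1/2}`. -/
theorem feature_velocity_bound
    {n m D : ℕ} (hm : 0 < m) (hD : 0 < D)
    (φ : Fin D → α → ℝ) (x : Fin n → α) (y : Fin n → ℝ)
    (σ : ℝ → ℝ) (Lσ : ℝ) (hLσ : 0 < Lσ)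
    (hσdiff : Differentiable ℝ σ) (hσlip : LipschitzWith (Real.toNNReal Lσ) σ)
    (chat : ℝ) (hchat : 0 < chat) (c : Fin m → ℝ) (hc : ∀ i, |c i| = chat)
    (lamMin lamMax : ℝ) (hlamMinpos : 0 < lamMin)
    (hlamMin : ∀ v : Fin n → ℝ,
      lamMin * ∑ a, (v a) ^ 2 ≤ ∑ a, ∑ b, v a * gram φ x a b * v b)
    (hlamMax : ∀ v : Fin n → ℝ,
      ∑ a, ∑ b, v a * gram φ x a b * v b ≤ lamMax * ∑ a, (v a) ^ 2)
    (W : ℝ → Fin m → Fin D → ℝ) (hGF : IsGF c σ φ x y W) :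
    ∀ t : ℝ, 0 ≤ t → ∀ L' : ℝ,
      HasDerivAt (fun s => sqLoss c σ φ x y (W s)) L' t →
      ∀ a : Fin n,
        (m : ℝ)⁻¹ * ∑ i,
            |(-(c i)) * ∑ b, gram φ x a b * (net c σ φ (W t) (x b) - y b)
                * deriv σ (feat φ (W t) i (x b))|
          ≤ lamMax * (Real.sqrt lamMin)⁻¹ * Real.sqrt |L'| := by
  intro t ht L' hL a
  set r : Fin n → ℝ := fun b => net c σ φ (W t) (x b) - y b with hr
  set v : Fin m → Fin n → ℝ := fun i b => r b * deriv σ (feat φ (W t) i (x b)) with hv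
  have hm' : (0 : ℝ) < m := by exact_mod_cast hm
  have hnet : ∀ b, HasDerivAt (fun s => net c σ φ (W s) (x b)) _ t := fun b =>
    (HasDerivAt.fun_sum (u := Finset.univ) (fun i _ =>
      (((hσdiff (feat φ (W t) i (x b))).hasDerivAt.comp t
        (feat_deriv_aux hD φ x y σ c W hGF t ht i b)).const_mul (c i)))).const_mul ((m : ℝ)⁻¹)
  have hloss : HasDerivAt (fun s => sqLoss c σ φ x y (W s)) _ t :=
    (HasDerivAt.fun_sum (u := Finset.univ) (fun b _ =>
      ((hnet b).sub_const (y b)).fun_pow 2)).const_mul (1/2 : ℝ)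
  have hLeq := hL.unique hloss
  have hLeq2 : L' = -((m : ℝ)⁻¹ * ∑ i, chat ^ 2 * ∑ b, ∑ d, v i b * gram φ x b d * v i d) := by
    rw [hLeq]
    have hc2 : ∀ i, chat ^ 2 = c i ^ 2 := fun i => by rw [← hc i, sq_abs]
    simp only [Finset.mul_sum, Finset.sum_mul, ← Finset.sum_neg_distrib, hv, hr]
    rw [Finset.sum_comm]
    refine Finset.sum_congr rfl fun i _ => Finset.sum_congr rfl fun b _ =>
      Finset.sum_congr rfl fun d _ => ?_
    rw [hc2 i]
    push_cast
    ring
  set S : ℝ := ∑ i, ∑ b, v i b ^ 2 with hS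
  have hS0 : 0 ≤ S := by positivity
  have hlow : (m : ℝ)⁻¹ * (chat ^ 2 * (lamMin * S)) ≤ |L'| := by
    rw [hLeq2, abs_neg]
    refine le_trans ?_ (le_abs_self _)
    rw [hS, Finset.mul_sum, Finset.mul_sum]
    gcongr with i
    exact hlamMin (v i)
  have hMax0 := (gram_row_aux φ x lamMax hlamMax 0 a).1
  set g : Fin m → ℝ := fun i => |(-(c i)) * ∑ b, gram φ x a b * (net c σ φ (W t) (x b) - y b)
                * deriv σ (feat φ (W t) i (x b))| with hg
  have hgi : ∀ i, g i ^ 2 ≤ chat ^ 2 * (lamMax ^ 2 * ∑ b, v i b ^ 2) := by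
    intro i
    have h := (gram_row_aux φ x lamMax hlamMax (v i) a).2
    have e : g i = chat * |∑ b, gram φ x a b * v i b| := by
      simp only [hg, hv, hr, abs_mul, abs_neg, hc, mul_assoc]
    rw [e, mul_pow, sq_abs]
    gcongr
  have hsum : (∑ i, g i) ^ 2 ≤ m * (chat ^ 2 * (lamMax ^ 2 * S)) := by
    have h := sq_sum_le_card_mul_sum_sq (s := Finset.univ) (f := g)
    simp only [Finset.card_univ, Fintype.card_fin] at h
    refine h.trans (mul_le_mul_of_nonneg_left ?_ hm'.le)
    rw [hS, Finset.mul_sum, Finset.mul_sum]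
    exact Finset.sum_le_sum fun i _ => hgi i
  refine le_of_abs_le (abs_le_of_sq_le_sq ?_ (by positivity))
  rw [mul_pow, mul_pow, mul_pow, inv_pow, inv_pow, Real.sq_sqrt hlamMinpos.le,
    Real.sq_sqrt (abs_nonneg _)]
  calc ((m : ℝ) ^ 2)⁻¹ * (∑ i, g i) ^ 2
      ≤ ((m : ℝ) ^ 2)⁻¹ * (m * (chat ^ 2 * (lamMax ^ 2 * S))) := by gcongr
    _ = lamMax ^ 2 * lamMin⁻¹ * ((m : ℝ)⁻¹ * (chat ^ 2 * (lamMin * S))) := by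
        field_simp
    _ ≤ _ := by gcongr

end GFPaper
end
end

section
/- Along any gradient-flow trajectory with λ_min(G) > 0 and |c_i| = ĉ > 0 for all i, for every ξ > 0 and every t ≥ 0, the fraction of neurons whose pre-activation at any training point has moved by at least ξ since initialization is bounded as max_{a∈[n]} (1/m) ∑_{i=1}^m 1{|h_i^t(x_a) − h_i^0(x_a)| ≥ ξ} ≤ λ_max(G) (λ_min(G))^{−1/2} ξ^{−1} ∫_0^t |dL^s/ds|^{1/2} ds. -/
open Real MeasureTheory ProbabilityTheory
open scoped BigOperators ENNReal NNReal

noncomputable section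

namespace GFPaper

variable {α : Type*}

theorem feat_deriv {m D : ℕ} (φ : Fin D → α → ℝ) (W : ℝ → Fin m → Fin D → ℝ)
    (c : Fin m → ℝ) (p : Fin m → Fin D → ℝ) (t : ℝ)
    (h : ∀ i j, HasDerivAt (fun s => W s i j) (-(c i / Real.sqrt D) * p i j) t)
    (i : Fin m) (z : α) :
    HasDerivAt (fun s => feat φ (W s) i z) (-(c i) * ((D : ℝ)⁻¹ * ∑ j, p i j * φ j z)) t := by
  have h1 := (HasDerivAt.fun_sum (u := Finset.univ)
    (fun j _ => (h i j).mul_const (φ j z))).const_mul ((Real.sqrt D)⁻¹)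
  unfold feat
  refine h1.congr_deriv (Eq.symm ?_)
  have hs : (D : ℝ)⁻¹ = (Real.sqrt D)⁻¹ * (Real.sqrt D)⁻¹ := by
    rw [← mul_inv, Real.mul_self_sqrt (Nat.cast_nonneg D)]
  rw [hs, Finset.mul_sum, Finset.mul_sum, Finset.mul_sum]
  refine Finset.sum_congr rfl fun j _ => ?_
  ring

theorem loss_deriv_s5 {n m D : ℕ} (c : Fin m → ℝ) (σ : ℝ → ℝ) (hσ : Differentiable ℝ σ)
    (φ : Fin D → α → ℝ) (x : Fin n → α) (y : Fin n → ℝ) (W : ℝ → Fin m → Fin D → ℝ) (t : ℝ)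
    (H : Fin m → Fin n → ℝ)
    (h : ∀ i a, HasDerivAt (fun s => feat φ (W s) i (x a)) (H i a) t) :
    HasDerivAt (fun s => sqLoss c σ φ x y (W s))
      (∑ a, (net c σ φ (W t) (x a) - y a) *
        ((m : ℝ)⁻¹ * ∑ i, c i * (deriv σ (feat φ (W t) i (x a)) * H i a))) t := by
  have hn : ∀ a, HasDerivAt (fun s => net c σ φ (W s) (x a))
      ((m : ℝ)⁻¹ * ∑ i, c i * (deriv σ (feat φ (W t) i (x a)) * H i a)) t := by
    intro a
    unfold net
    refine (HasDerivAt.fun_sum fun i _ => ?_).const_mul _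
    refine HasDerivAt.const_mul _ ?_
    exact (hσ (feat φ (W t) i (x a))).hasDerivAt.comp t (h i a)
  have h1 := (HasDerivAt.fun_sum (u := Finset.univ)
    (fun a _ => ((hn a).sub_const (y a)).pow 2)).const_mul (1/2 : ℝ)
  unfold sqLoss
  refine h1.congr_deriv (Eq.symm ?_)
  rw [Finset.mul_sum]
  refine Finset.sum_congr rfl fun j _ => ?_
  push_cast
  ring

theorem loss_formula {n m D : ℕ} (c : Fin m → ℝ) (r : Fin n → ℝ) (d : Fin m → Fin n → ℝ)
    (F : Fin D → Fin n → ℝ) (M E : ℝ) :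
    (∑ a, r a * (M * ∑ i, c i * (d i a * (-(c i) *
        (E * ∑ j, (∑ b, r b * d i b * F j b) * F j a)))))
      = -(M * ∑ i, c i ^ 2 * (E * ∑ j, (∑ b, r b * d i b * F j b) ^ 2)) := by
  have : ∀ i, (∑ j, (∑ b, r b * d i b * F j b) ^ 2)
      = ∑ a, r a * d i a * ∑ j, (∑ b, r b * d i b * F j b) * F j a := by
    intro i
    simp_rw [Finset.mul_sum]
    rw [Finset.sum_comm]
    refine Finset.sum_congr rfl fun j _ => ?_
    rw [sq, Finset.mul_sum]
    refine Finset.sum_congr rfl fun a _ => ?_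
    ring
  simp_rw [this]
  generalize hS : (fun i a => ∑ j, (∑ b, r b * d i b * F j b) * F j a) = S
  have hS' : ∀ i a, ∑ j, (∑ b, r b * d i b * F j b) * F j a = S i a := by
    intro i a; rw [← hS]
  simp_rw [hS', Finset.mul_sum]
  rw [Finset.sum_comm, ← Finset.sum_neg_distrib]
  refine Finset.sum_congr rfl fun i _ => ?_
  rw [← Finset.sum_neg_distrib]
  refine Finset.sum_congr rfl fun a _ => ?_
  ring

theorem avg_bound {m D : ℕ} (hm : 0 < m) (c : Fin m → ℝ) (p : Fin m → Fin D → ℝ)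
    (f : Fin D → ℝ) (E lamMin lamMax : ℝ) (hE : 0 ≤ E) (hlm : 0 < lamMin) (hle : lamMin ≤ lamMax)
    (hf : E * ∑ j, f j * f j ≤ lamMax) :
    (m : ℝ)⁻¹ * ∑ i, |-(c i) * (E * ∑ j, p i j * f j)| ≤
      lamMax * (Real.sqrt lamMin)⁻¹ *
        Real.sqrt |-((m : ℝ)⁻¹ * ∑ i, c i ^ 2 * (E * ∑ j, p i j ^ 2))| := by
  have hM : (0 : ℝ) < m := by exact_mod_cast hm
  have hM0 : (0 : ℝ) ≤ (m : ℝ)⁻¹ := by positivity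
  set Q := (m : ℝ)⁻¹ * ∑ i, c i ^ 2 * (E * ∑ j, p i j ^ 2) with hQ
  have hQ0 : 0 ≤ Q := by
    apply mul_nonneg hM0
    exact Finset.sum_nonneg fun i _ => mul_nonneg (sq_nonneg _)
      (mul_nonneg hE (Finset.sum_nonneg fun j _ => sq_nonneg _))
  rw [abs_neg, abs_of_nonneg hQ0]
  have hmax : 0 < lamMax := hlm.trans_le hle
  have hsq : ((m : ℝ)⁻¹ * ∑ i, |-(c i) * (E * ∑ j, p i j * f j)|) ^ 2 ≤ lamMax * Q := by
    have h1 := sq_sum_le_card_mul_sum_sq (s := (Finset.univ : Finset (Fin m)))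
      (f := fun i => |-(c i) * (E * ∑ j, p i j * f j)|)
    simp only [Finset.card_univ, Fintype.card_fin] at h1
    have h2 : ∀ i, |-(c i) * (E * ∑ j, p i j * f j)| ^ 2
        ≤ lamMax * (c i ^ 2 * (E * ∑ j, p i j ^ 2)) := by
      intro i
      rw [sq_abs]
      have h3 := Finset.sum_mul_sq_le_sq_mul_sq Finset.univ (p i) f
      have h4 : (∑ j, f j ^ 2) = ∑ j, f j * f j :=
        Finset.sum_congr rfl fun j _ => sq _
      rw [h4] at h3
      have h5 : 0 ≤ ∑ j, p i j ^ 2 := Finset.sum_nonneg fun j _ => sq_nonneg _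
      calc (-(c i) * (E * ∑ j, p i j * f j)) ^ 2
          = (c i ^ 2 * E ^ 2) * (∑ j, p i j * f j) ^ 2 := by ring
        _ ≤ (c i ^ 2 * E ^ 2) * ((∑ j, p i j ^ 2) * ∑ j, f j * f j) := by gcongr
        _ = (E * ∑ j, f j * f j) * (c i ^ 2 * (E * ∑ j, p i j ^ 2)) := by ring
        _ ≤ lamMax * (c i ^ 2 * (E * ∑ j, p i j ^ 2)) := by gcongr
    calc ((m : ℝ)⁻¹ * ∑ i, |-(c i) * (E * ∑ j, p i j * f j)|) ^ 2
        = (m : ℝ)⁻¹ ^ 2 * (∑ i, |-(c i) * (E * ∑ j, p i j * f j)|) ^ 2 := by ring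
      _ ≤ (m : ℝ)⁻¹ ^ 2 * (m * ∑ i, |-(c i) * (E * ∑ j, p i j * f j)| ^ 2) := by gcongr
      _ = (m : ℝ)⁻¹ * ∑ i, |-(c i) * (E * ∑ j, p i j * f j)| ^ 2 := by
          generalize (∑ i, |-(c i) * (E * ∑ j, p i j * f j)| ^ 2) = S
          field_simp
      _ ≤ (m : ℝ)⁻¹ * ∑ i, lamMax * (c i ^ 2 * (E * ∑ j, p i j ^ 2)) := by
          gcongr with i _
          exact h2 i
      _ = lamMax * Q := by rw [← Finset.mul_sum, hQ]; ring
  refine (Real.le_sqrt_of_sq_le hsq).trans ?_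
  rw [Real.sqrt_mul hmax.le]
  gcongr
  rw [← div_eq_mul_inv, le_div_iff₀ (Real.sqrt_pos.2 hlm)]
  calc √lamMax * √lamMin ≤ √lamMax * √lamMax := by gcongr
    _ = lamMax := Real.mul_self_sqrt hmax.le

/-- Along any gradient-flow trajectory with `λ_min(G) > 0` and `|c_i| = ĉ > 0`,
for every `ξ > 0` and `t ≥ 0`, the fraction of neurons whose pre-activation at any training
point has moved by at least `ξ` since initialization satisfies
`max_a (1/m) ∑_i 1{|h_i^t(x_a) - h_i^0(x_a)| ≥ ξ}
  ≤ λ_max(G) λ_min(G)^{-1/2} ξ⁻¹ ∫_0^t |dL^s/ds|^{1/2} ds`. -/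
theorem moved_fraction_bound
    {n m D : ℕ} (hm : 0 < m) (hD : 0 < D)
    (φ : Fin D → α → ℝ) (x : Fin n → α) (y : Fin n → ℝ)
    (σ : ℝ → ℝ) (Lσ : ℝ) (hLσ : 0 < Lσ)
    (hσdiff : Differentiable ℝ σ) (hσlip : LipschitzWith (Real.toNNReal Lσ) σ)
    (chat : ℝ) (hchat : 0 < chat) (c : Fin m → ℝ) (hc : ∀ i, |c i| = chat)
    (lamMin lamMax : ℝ) (hlamMinpos : 0 < lamMin)
    (hlamMin : ∀ v : Fin n → ℝ,
      lamMin * ∑ a, (v a) ^ 2 ≤ ∑ a, ∑ b, v a * gram φ x a b * v b)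
    (hlamMax : ∀ v : Fin n → ℝ,
      ∑ a, ∑ b, v a * gram φ x a b * v b ≤ lamMax * ∑ a, (v a) ^ 2)
    (W : ℝ → Fin m → Fin D → ℝ) (hGF : IsGF c σ φ x y W)
    (L' : ℝ → ℝ)
    (hL' : ∀ s : ℝ, 0 ≤ s → HasDerivAt (fun r => sqLoss c σ φ x y (W r)) (L' s) s) :
    ∀ ξ : ℝ, 0 < ξ → ∀ t : ℝ, 0 ≤ t → ∀ a : Fin n,
      (m : ℝ)⁻¹ * ∑ i,
          (if ξ ≤ |feat φ (W t) i (x a) - feat φ (W 0) i (x a)| then (1 : ℝ) else 0)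
        ≤ lamMax * (Real.sqrt lamMin)⁻¹ * ξ⁻¹ * ∫ s in (0 : ℝ)..t, Real.sqrt |L' s| := by
  intro ξ hξ t ht a
  have hM : (0 : ℝ) < m := by exact_mod_cast hm
  -- Gram diagonal bounds
  have hsing : ∑ b, (Pi.single a (1 : ℝ) : Fin n → ℝ) b ^ 2 = 1 := by
    simp [Pi.single_apply]
  have hsing2 : ∑ a', ∑ b, (Pi.single a (1 : ℝ) : Fin n → ℝ) a' * gram φ x a' b *
      (Pi.single a (1 : ℝ) : Fin n → ℝ) b = gram φ x a a := by
    simp [Pi.single_apply]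
  have hgmin := hlamMin (Pi.single a 1)
  have hgmax := hlamMax (Pi.single a 1)
  rw [hsing, hsing2, mul_one] at hgmin hgmax
  have hle : lamMin ≤ lamMax := hgmin.trans hgmax
  let r : ℝ → Fin n → ℝ := fun s b => net c σ φ (W s) (x b) - y b
  let d : ℝ → Fin m → Fin n → ℝ := fun s i b => deriv σ (feat φ (W s) i (x b))
  let p : ℝ → Fin m → Fin D → ℝ := fun s i j => ∑ b, r s b * d s i b * φ j (x b)
  let H : ℝ → Fin m → ℝ := fun s i => -(c i) * ((D : ℝ)⁻¹ * ∑ j, p s i j * φ j (x a))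
  have hH : ∀ s, 0 ≤ s → ∀ i b, HasDerivAt (fun s => feat φ (W s) i (x b))
      (-(c i) * ((D : ℝ)⁻¹ * ∑ j, p s i j * φ j (x b))) s := fun s hs i b =>
    feat_deriv φ W c (p s) s (fun i j => hGF s hs i j) i (x b)
  have hLf : ∀ s, 0 ≤ s →
      L' s = -((m : ℝ)⁻¹ * ∑ i, c i ^ 2 * ((D : ℝ)⁻¹ * ∑ j, p s i j ^ 2)) := by
    intro s hs
    have h1 := loss_deriv_s5 c σ hσdiff φ x y W s _ (hH s hs)
    rw [(hL' s hs).unique h1]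
    exact loss_formula c (r s) (d s) (fun j b => φ j (x b)) _ _
  have hLneg : ∀ s, 0 ≤ s → L' s ≤ 0 := by
    intro s hs
    rw [hLf s hs, neg_nonpos]
    positivity
  have hbd : ∀ s, 0 ≤ s → (m : ℝ)⁻¹ * ∑ i, |H s i| ≤
      lamMax * (Real.sqrt lamMin)⁻¹ * Real.sqrt |L' s| := by
    intro s hs
    rw [hLf s hs]
    exact avg_bound hm c (p s) (fun j => φ j (x a)) _ lamMin lamMax (by positivity)
      hlamMinpos hle hgmax
  -- integrability
  have hLint : IntervalIntegrable L' volume 0 t := by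
    have h1 : IntervalIntegrable (fun s => -L' s) volume 0 t := by
      rw [intervalIntegrable_iff_integrableOn_Ioc_of_le ht]
      refine intervalIntegral.integrableOn_deriv_of_nonneg
        (g := fun s => -sqLoss c σ φ x y (W s)) ?_ ?_ ?_
      · intro s hs
        exact (hL' s hs.1).neg.continuousAt.continuousWithinAt
      · intro s hs
        exact (hL' s hs.1.le).fun_neg
      · intro s hs
        have := hLneg s hs.1.le
        linarith
    exact h1.neg.congr (fun s _ => by simp)
  have hsqint : IntervalIntegrable (fun s => Real.sqrt |L' s|) volume 0 t := by
    rw [intervalIntegrable_iff] at hLint ⊢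
    refine Integrable.mono' (g := fun s => 1 + |L' s|) ?_ ?_ ?_
    · exact (integrableOn_const (by simp)).add hLint.abs
    · exact Real.continuous_sqrt.comp_aestronglyMeasurable hLint.abs.aestronglyMeasurable
    · refine Filter.Eventually.of_forall fun s => ?_
      rw [Real.norm_of_nonneg (Real.sqrt_nonneg _)]
      have h0 := abs_nonneg (L' s)
      rw [Real.sqrt_le_left (by positivity)]
      nlinarith
  have hHint : ∀ i, IntervalIntegrable (fun s => H s i) volume 0 t := by
    intro i
    rw [intervalIntegrable_iff_integrableOn_Ioc_of_le ht] at hsqint ⊢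
    refine Integrable.mono' (g := fun s => m * (lamMax * (Real.sqrt lamMin)⁻¹ *
      Real.sqrt |L' s|)) ((hsqint.const_mul _).const_mul _) ?_ ?_
    · refine AEStronglyMeasurable.congr
        (f := deriv (fun s => feat φ (W s) i (x a)))
        (aestronglyMeasurable_deriv _ _) ?_
      filter_upwards [ae_restrict_mem measurableSet_Ioc] with s hs
      exact (hH s hs.1.le i a).deriv
    · filter_upwards [ae_restrict_mem measurableSet_Ioc] with s hs
      have h1 := hbd s hs.1.le
      rw [inv_mul_le_iff₀ hM] at h1
      refine le_trans ?_ h1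
      exact Finset.single_le_sum (f := fun i => |H s i|) (fun i _ => abs_nonneg _)
        (Finset.mem_univ i)
  have hmove : ∀ i, |feat φ (W t) i (x a) - feat φ (W 0) i (x a)| ≤ ∫ s in (0:ℝ)..t, |H s i| := by
    intro i
    have h1 := intervalIntegral.integral_eq_sub_of_hasDerivAt
      (f := fun s => feat φ (W s) i (x a)) (f' := fun s => H s i) (a := 0) (b := t)
      (fun s hs => hH s (by rw [Set.uIcc_of_le ht] at hs; exact hs.1) i a) (hHint i)
    rw [← h1]
    exact intervalIntegral.abs_integral_le_integral_abs ht
  calc (m : ℝ)⁻¹ * ∑ i,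
          (if ξ ≤ |feat φ (W t) i (x a) - feat φ (W 0) i (x a)| then (1 : ℝ) else 0)
      ≤ (m : ℝ)⁻¹ * ∑ i, ξ⁻¹ * ∫ s in (0:ℝ)..t, |H s i| := by
        gcongr with i _
        refine le_trans ?_ (mul_le_mul_of_nonneg_left (hmove i) (by positivity))
        split_ifs with h
        · rw [inv_mul_eq_div, le_div_iff₀ hξ, one_mul]
          exact h
        · positivity
    _ = ξ⁻¹ * ∫ s in (0:ℝ)..t, (m : ℝ)⁻¹ * ∑ i, |H s i| := by
        rw [intervalIntegral.integral_const_mul, intervalIntegral.integral_finsetSum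
          (fun i _ => (hHint i).abs), ← Finset.mul_sum]
        ring
    _ ≤ ξ⁻¹ * ∫ s in (0:ℝ)..t, lamMax * (Real.sqrt lamMin)⁻¹ * Real.sqrt |L' s| := by
        gcongr
        refine intervalIntegral.integral_mono_on ht ?_ (hsqint.const_mul _)
          (fun s hs => hbd s hs.1)
        refine IntervalIntegrable.const_mul ?_ _
        have := IntervalIntegrable.sum (μ := volume) (a := 0) (b := t) Finset.univ
          (f := fun i s => |H s i|) (fun i _ => (hHint i).abs)
        refine this.congr (fun s _ => ?_)
        simp
    _ = _ := by
        rw [intervalIntegral.integral_const_mul]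
        ring


end GFPaper
end
end
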